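/- (Pointwise maximal-function domination for the kinetic kernels, Step 3 of the proof of Theorem 4.2.) There exists a constant C > 0 such that for every r > 0, every z ∈ ℝ^{1+2d}, every bounded measurable g : ℝ^{1+2d} → ℝ^d, every bounded measurable u : ℝ^{1+2d} → ℝ, and every ℓ ∈ {1,…,d}: (i) |[T_{K⃗_r} g](z)| + |[T_{K⃗^π_r} g](z)| ≤ C [M_kin |g|](z); (ii) |[T_{∂_{y_ℓ} K⃗_r} g](z)| + |[T_{∂_{y_ℓ} K⃗^π_r} g](z)| ≤ C r^{−3} [M_kin |g|](z); (iii) |[T_{K̃_r} u](z)| ≤ C [M_{kin,1} |u|](z); (iv) |[T_{∂_{y_ℓ} K̃_r} u](z)| ≤ C r^{−3} [M_{kin,1} |u|](z). -/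

import Mathlib

open MeasureTheory Real ENNReal
open scoped RealInnerProductSpace

noncomputable section

/-- Euclidean space `ℝ^d`. -/
abbrev V (d : ℕ) : Type := EuclideanSpace ℝ (Fin d)

/-- The kinetic phase space `ℝ^{1+2d}`, with points `(t, x, v)`. -/
abbrev Pt (d : ℕ) : Type := ℝ × V d × V d

/-- Kinetic composition `(t,x,v) ∘ (s,y,w) = (t+s, x+y+s v, v+w)`. -/
def kmul {d : ℕ} (a b : Pt d) : Pt d :=
  (a.1 + b.1, a.2.1 + b.2.1 + b.1 • a.2.2, a.2.2 + b.2.2)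

/-- Kinetic inverse `(t,x,v)⁻¹ = (−t, −x+t v, −v)`. -/
def kinv {d : ℕ} (a : Pt d) : Pt d :=
  (-a.1, -a.2.1 + a.1 • a.2.2, -a.2.2)

/-- `g₁(r) = r³ sin(log r)`, extended by `0` at `r = 0`. -/
def g1 (r : ℝ) : ℝ := r ^ 3 * Real.sin (Real.log r)

/-- `g₂(r) = r³ cos(log r)`, extended by `0` at `r = 0`. -/
def g2 (r : ℝ) : ℝ := r ^ 3 * Real.cos (Real.log r)

/-- `ġ₁(r)/(2r) = (r/2)(3 sin(log r) + cos(log r))`, extended by `0` at `r = 0`. -/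
def h1 (r : ℝ) : ℝ := r / 2 * (3 * Real.sin (Real.log r) + Real.cos (Real.log r))

/-- `ġ₂(r)/(2r) = (r/2)(3 cos(log r) − sin(log r))`, extended by `0` at `r = 0`. -/
def h2 (r : ℝ) : ℝ := r / 2 * (3 * Real.cos (Real.log r) - Real.sin (Real.log r))

/-- The matrix `W(r)`, recorded through its scalar block entries as a `2×2` real matrix;
the full `2d×2d` matrix is the blockwise tensor with `Id_d`. -/
def Wm (r : ℝ) : Matrix (Fin 2) (Fin 2) ℝ := !![g1 r, g2 r; h1 r, h2 r]

/-- The matrix `D_δ` (scalar block entries). -/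
def Dm (δ : ℝ) : Matrix (Fin 2) (Fin 2) ℝ := !![δ, 0; 0, 1]

/-- The matrix `E_δ(r)` (scalar block entries). -/
def Em (δ r : ℝ) : Matrix (Fin 2) (Fin 2) ℝ := !![1, δ * r ^ 2; 0, 1]

/-- `A_{m₀}(r) = D_{m₀} W(r) D_{m₀}⁻¹` (scalar block entries). -/
def Am (m0 r : ℝ) : Matrix (Fin 2) (Fin 2) ℝ := Dm m0 * Wm r * (Dm m0)⁻¹

/-- The action on `ℝ^d × ℝ^d` of a `2×2` block matrix whose blocks are the scalar
multiples of `Id_d` given by the entries of `M`. -/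
def act {d : ℕ} (M : Matrix (Fin 2) (Fin 2) ℝ) (p : V d × V d) : V d × V d :=
  (M 0 0 • p.1 + M 0 1 • p.2, M 1 0 • p.1 + M 1 1 • p.2)

/-- The kinetic trajectory `γ^m(r; (t,x,v))`. -/
def gammaK {d : ℕ} (m : Pt d) (z : Pt d) (r : ℝ) : Pt d :=
  (z.1 + m.1 * r ^ 2,
   (act (Em m.1 r) (z.2.1, z.2.2) + act (Am m.1 r) (m.2.1, m.2.2)).1,
   (act (Em m.1 r) (z.2.1, z.2.2) + act (Am m.1 r) (m.2.1, m.2.2)).2)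

/-- Build a vector of `ℝ^d` from components. -/
def mkV {d : ℕ} (f : Fin d → ℝ) : V d := (EuclideanSpace.equiv (Fin d) ℝ).symm f

/-- The argument `(s/r², A_{s/r²}(r)⁻¹ (y,w)ᵀ)` fed into `ψ`. -/
def psiArg {d : ℕ} (r : ℝ) (m : Pt d) : Pt d :=
  (m.1 / r ^ 2,
   (act ((Am (m.1 / r ^ 2) r)⁻¹) (m.2.1, m.2.2)).1,
   (act ((Am (m.1 / r ^ 2) r)⁻¹) (m.2.1, m.2.2)).2)

/-- The mollification kernel `K_r(s,y,w) = 2^d r^{−Q} ψ(s/r², A_{s/r²}(r)⁻¹(y,w)ᵀ)`,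
with `Q = 4d+2`. -/
def Kker {d : ℕ} (ψ : Pt d → ℝ) (r : ℝ) (m : Pt d) : ℝ :=
  2 ^ d * r ^ (-(4 * (d : ℤ) + 2)) * ψ (psiArg r m)

/-- The kernel `K̃_r(s,y,w) = −2^{d+1} s r^{−Q−1} ψ(s/r², A_{s/r²}(r)⁻¹(y,w)ᵀ)`. -/
def Ktil {d : ℕ} (ψ : Pt d → ℝ) (r : ℝ) (m : Pt d) : ℝ :=
  -(2 ^ (d + 1)) * m.1 * r ^ (-(4 * (d : ℤ) + 2) - 1) * ψ (psiArg r m)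

/-- First coefficient of the forcing matrix `F_{m₀}(r)`: `(1/m₀) ∂_r (ġ₁(r)/(2r))`. -/
def F1 (m0 r : ℝ) : ℝ := (1 / m0) * deriv h1 r

/-- Second coefficient of the forcing matrix `F_{m₀}(r)`: `∂_r (ġ₂(r)/(2r))`. -/
def F2 (r : ℝ) : ℝ := deriv h2 r

/-- The kernel `K⃗_r(s,y,w) = −2^d r^{−Q} ψ(⋯) F_{s/r²}(r) A_{s/r²}(r)⁻¹ (y,w)ᵀ ∈ ℝ^d`. -/
def Kvec {d : ℕ} (ψ : Pt d → ℝ) (r : ℝ) (m : Pt d) : V d :=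
  (-(2 ^ d) * r ^ (-(4 * (d : ℤ) + 2)) * ψ (psiArg r m)) •
    (F1 (m.1 / r ^ 2) r • (act ((Am (m.1 / r ^ 2) r)⁻¹) (m.2.1, m.2.2)).1 +
      F2 r • (act ((Am (m.1 / r ^ 2) r)⁻¹) (m.2.1, m.2.2)).2)

/-- The gradient of `u : ℝ^{1+2d} → ℝ` in the `x`-variables (the `m₁` block). -/
def gradX {d : ℕ} (u : Pt d → ℝ) (z : Pt d) : V d :=
  mkV fun i => fderiv ℝ u z (0, EuclideanSpace.single i 1, 0)

/-- The gradient of `u : ℝ^{1+2d} → ℝ` in the `v`-variables (the `m₂` block). -/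
def gradV {d : ℕ} (u : Pt d → ℝ) (z : Pt d) : V d :=
  mkV fun i => fderiv ℝ u z (0, 0, EuclideanSpace.single i 1)

/-- The kernel `K⃗^π_r(s,y,w)
  = 2^{d+1} s r^{−Q−1} [(A_{s/r²}(r)⁻¹)_{·;2}]ᵀ [∇_{(m₁,m₂)}ψ](⋯) ∈ ℝ^d`. -/
def Kpi {d : ℕ} (ψ : Pt d → ℝ) (r : ℝ) (m : Pt d) : V d :=
  (2 ^ (d + 1) * m.1 * r ^ (-(4 * (d : ℤ) + 2) - 1)) •
    ((Am (m.1 / r ^ 2) r)⁻¹ 0 1 • gradX ψ (psiArg r m) +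
      (Am (m.1 / r ^ 2) r)⁻¹ 1 1 • gradV ψ (psiArg r m))

/-- Kinetic convolution operator for scalar kernels:
`[T_J f](z) = ∫ J(z⁻¹ ∘ m) f(m) dm`. -/
def Tsc {d : ℕ} (J : Pt d → ℝ) (f : Pt d → ℝ) (z : Pt d) : ℝ :=
  ∫ m, J (kmul (kinv z) m) * f m

/-- Kinetic convolution operator for `ℝ^d`-valued kernels:
`[T_J f](z) = ∫ J(z⁻¹ ∘ m) · f(m) dm`. -/
def Tvec {d : ℕ} (J : Pt d → V d) (f : Pt d → V d) (z : Pt d) : ℝ :=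
  ∫ m, ⟪J (kmul (kinv z) m), f m⟫

/-- The support and nonnegativity conditions on the bump function `ψ`:
smooth, nonnegative, unit mass, supported in `(−2,−1) × B₁(0) × B₁(0)`. -/
structure IsKineticBump {d : ℕ} (ψ : Pt d → ℝ) : Prop where
  smooth : ContDiff ℝ (⊤ : ℕ∞) ψ
  nonneg : ∀ m, 0 ≤ ψ m
  mass : ∫ m, ψ m = 1
  supp : ∀ m : Pt d, ψ m ≠ 0 →
    m.1 ∈ Set.Ioo (-2 : ℝ) (-1) ∧ ‖m.2.1‖ < 1 ∧ ‖m.2.2‖ < 1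

/-- The kinetic box `B_r^kin = {(s,y,w) : |s| < r², |y| < r³, |w| < r}`. -/
def kinBox (d : ℕ) (r : ℝ) : Set (Pt d) :=
  {m | |m.1| < r ^ 2 ∧ ‖m.2.1‖ < r ^ 3 ∧ ‖m.2.2‖ < r}

/-- The kinetic maximal operator
`[M_kin g](z) = sup_{r>0} |B_r^kin|⁻¹ ∫_{B_r^kin} |g(z ∘ m)| dm` (valued in `ℝ≥0∞`). -/
def Mkin {d : ℕ} (g : Pt d → ℝ) (z : Pt d) : ℝ≥0∞ :=
  ⨆ (r : ℝ) (_ : 0 < r),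
    (volume (kinBox d r))⁻¹ * ∫⁻ m in kinBox d r, ENNReal.ofReal |g (kmul z m)|

/-- The order-one kinetic maximal operator
`[M_{kin,1} g](z) = sup_{r>0} r |B_r^kin|⁻¹ ∫_{B_r^kin} |g(z ∘ m)| dm`. -/
def Mkin1 {d : ℕ} (g : Pt d → ℝ) (z : Pt d) : ℝ≥0∞ :=
  ⨆ (r : ℝ) (_ : 0 < r),
    ENNReal.ofReal r *
      ((volume (kinBox d r))⁻¹ * ∫⁻ m in kinBox d r, ENNReal.ofReal |g (kmul z m)|)

/-- Partial derivative `∂_{y_ℓ}` of an `ℝ^d`-valued kernel in the spatial kernel variable. -/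
def pdYv {d : ℕ} (J : Pt d → V d) (ℓ : Fin d) (m : Pt d) : V d :=
  fderiv ℝ (fun y : V d => J (m.1, y, m.2.2)) m.2.1 (EuclideanSpace.single ℓ 1)

/-- Partial derivative `∂_{y_ℓ}` of a scalar kernel in the spatial kernel variable. -/
def pdYs {d : ℕ} (J : Pt d → ℝ) (ℓ : Fin d) (m : Pt d) : ℝ :=
  fderiv ℝ (fun y : V d => J (m.1, y, m.2.2)) m.2.1 (EuclideanSpace.single ℓ 1)

section KernelBounds

variable {d : ℕ}

/-- A closed kinetic box containing the support of every kernel at scale `r`. -/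
def kernelBox (d : ℕ) (r : ℝ) : Set (Pt d) :=
  {m | |m.1| ≤ 2 * r ^ 2 ∧ ‖m.2.1‖ ≤ 3 * r ^ 3 ∧ ‖m.2.2‖ ≤ 4 * r}

/-- Size, support and spatial Lipschitz control of a kernel at scale `r`. -/
structure KernelBound {E : Type*} [NormedAddCommGroup E] (r B : ℝ) (J : Pt d → E) : Prop where
  bound : ∀ m, ‖J m‖ ≤ B
  supp : ∀ m, J m ≠ 0 → m ∈ kernelBox d r
  lip : ∀ s w y y', ‖J (s, y, w) - J (s, y', w)‖ ≤ B * r ^ (-3 : ℤ) * ‖y - y'‖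

/-- A bounded Lipschitz profile supported in `(−2,−1) × B₁(0) × B₁(0)`. -/
structure ProfileBound {E : Type*} [NormedAddCommGroup E] (M : ℝ) (Φ : Pt d → E) : Prop where
  bound : ∀ p, ‖Φ p‖ ≤ M
  supp : ∀ p, Φ p ≠ 0 → p.1 ∈ Set.Ioo (-2 : ℝ) (-1) ∧ ‖p.2.1‖ < 1 ∧ ‖p.2.2‖ < 1
  lip : ∀ p p', ‖Φ p - Φ p'‖ ≤ M * ‖p - p'‖

theorem exists_profileBound {E : Type*} [NormedAddCommGroup E] [NormedSpace ℝ E] {Φ : Pt d → E}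
    (hΦ : ContDiff ℝ 1 Φ)
    (hs : ∀ p, Φ p ≠ 0 → p.1 ∈ Set.Ioo (-2 : ℝ) (-1) ∧ ‖p.2.1‖ < 1 ∧ ‖p.2.2‖ < 1) :
    ∃ M, 0 ≤ M ∧ ProfileBound M Φ := by
  have hc : HasCompactSupport Φ := by
    refine HasCompactSupport.of_support_subset_isCompact
      (K := Set.Icc (-2 : ℝ) (-1) ×ˢ Metric.closedBall 0 1 ×ˢ Metric.closedBall 0 1)
      (isCompact_Icc.prod ((isCompact_closedBall _ _).prod (isCompact_closedBall _ _))) ?_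
    intro p hp
    obtain ⟨h1, h2, h3⟩ := hs p hp
    exact ⟨⟨h1.1.le, h1.2.le⟩, by simpa using h2.le, by simpa using h3.le⟩
  obtain ⟨M, hM⟩ := hc.exists_bound_of_continuous hΦ.continuous
  obtain ⟨K, hK⟩ := hΦ.lipschitzWith_of_hasCompactSupport hc one_ne_zero
  refine ⟨max M K, le_max_of_le_right K.2, fun p => (hM p).trans (le_max_left _ _), hs,
    fun p p' => (hK.norm_sub_le p p').trans ?_⟩
  gcongr
  exact le_max_right _ _

theorem Am_eq {δ : ℝ} (hδ : δ ≠ 0) (r : ℝ) : Am δ r = !![g1 r, δ * g2 r; h1 r / δ, h2 r] := by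
  have hD : (Dm δ)⁻¹ = !![δ⁻¹, 0; 0, 1] := by
    apply Matrix.inv_eq_right_inv
    ext i j
    fin_cases i <;> fin_cases j <;> simp [Dm, Matrix.mul_apply, hδ]
  rw [Am, hD]
  ext i j
  fin_cases i <;> fin_cases j <;>
    simp [Dm, Wm, Matrix.mul_apply, div_eq_mul_inv]
  field_simp

theorem det_Wm (r : ℝ) : g1 r * h2 r - g2 r * h1 r = -(r ^ 4 / 2) := by
  simp only [g1, g2, h1, h2]
  linear_combination (-(r ^ 4 / 2)) * Real.sin_sq_add_cos_sq (Real.log r)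

theorem Am_inv_eq {δ r : ℝ} (hδ : δ ≠ 0) (hr : 0 < r) :
    (Am δ r)⁻¹ = !![-(2 / r ^ 4) * h2 r, 2 / r ^ 4 * (δ * g2 r);
      2 / r ^ 4 * (h1 r / δ), -(2 / r ^ 4) * g1 r] := by
  apply Matrix.inv_eq_right_inv
  have h := det_Wm r
  have hr' := hr.ne'
  rw [Am_eq hδ]
  ext i j
  fin_cases i <;> fin_cases j <;> simp [Matrix.mul_apply] <;> field_simp
  · linear_combination (-2) * h
  · ring
  · ring
  · linear_combination (-2) * h

theorem act_act_inv {δ r : ℝ} (hδ : δ ≠ 0) (hr : 0 < r) (p : V d × V d) :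
    act (Am δ r) (act (Am δ r)⁻¹ p) = p := by
  have hdet : IsUnit (Am δ r).det := by
    rw [Am_eq hδ, Matrix.det_fin_two_of, isUnit_iff_ne_zero]
    have h := det_Wm r
    have : g1 r * h2 r - δ * g2 r * (h1 r / δ) = -(r ^ 4 / 2) := by
      rw [← h]; field_simp
    rw [this]
    have := hr.ne'
    simpa using this
  have h := Matrix.mul_nonsing_inv _ hdet
  have h00 := congrFun (congrFun h 0) 0
  have h01 := congrFun (congrFun h 0) 1
  have h10 := congrFun (congrFun h 1) 0
  have h11 := congrFun (congrFun h 1) 1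
  simp only [Matrix.mul_apply, Fin.sum_univ_two, Matrix.one_apply_eq, ne_eq, zero_ne_one,
    one_ne_zero, not_false_eq_true, Matrix.one_apply_ne] at h00 h01 h10 h11
  have comb : ∀ a b a₁ b₁ a₂ b₂ : ℝ, a • (a₁ • p.1 + b₁ • p.2) + b • (a₂ • p.1 + b₂ • p.2) =
      (a * a₁ + b * a₂) • p.1 + (a * b₁ + b * b₂) • p.2 := fun _ _ _ _ _ _ => by module
  refine Prod.ext ?_ ?_
  · simp only [act, comb, h00, h01, one_smul, zero_smul, add_zero]
  · simp only [act, comb, h10, h11, one_smul, zero_smul, zero_add]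

theorem abs_g1_le {r : ℝ} (hr : 0 < r) : |g1 r| ≤ r ^ 3 := by
  rw [g1, abs_mul, abs_of_pos (by positivity)]
  exact mul_le_of_le_one_right (by positivity) (Real.abs_sin_le_one _)

theorem abs_g2_le {r : ℝ} (hr : 0 < r) : |g2 r| ≤ r ^ 3 := by
  rw [g2, abs_mul, abs_of_pos (by positivity)]
  exact mul_le_of_le_one_right (by positivity) (Real.abs_cos_le_one _)

theorem abs_h1_le {r : ℝ} (hr : 0 < r) : |h1 r| ≤ 2 * r := by
  have h : |3 * Real.sin (Real.log r) + Real.cos (Real.log r)| ≤ 4 := by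
    rw [abs_le]
    constructor <;> linarith [Real.sin_le_one (Real.log r), Real.neg_one_le_sin (Real.log r),
      Real.cos_le_one (Real.log r), Real.neg_one_le_cos (Real.log r)]
  rw [h1, abs_mul, abs_of_pos (by positivity)]
  nlinarith

theorem abs_h2_le {r : ℝ} (hr : 0 < r) : |h2 r| ≤ 2 * r := by
  have h : |3 * Real.cos (Real.log r) - Real.sin (Real.log r)| ≤ 4 := by
    rw [abs_le]
    constructor <;> linarith [Real.sin_le_one (Real.log r), Real.neg_one_le_sin (Real.log r),
      Real.cos_le_one (Real.log r), Real.neg_one_le_cos (Real.log r)]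
  rw [h2, abs_mul, abs_of_pos (by positivity)]
  nlinarith

theorem abs_deriv_h1_le {r : ℝ} (hr : 0 < r) : |deriv h1 r| ≤ 3 := by
  have hl := Real.hasDerivAt_log hr.ne'
  have h : HasDerivAt h1 (Real.sin (Real.log r) + 2 * Real.cos (Real.log r)) r := by
    have := ((hasDerivAt_id r).div_const 2).mul ((hl.sin.const_mul 3).add hl.cos)
    refine this.congr_deriv ?_
    simp only [Pi.add_apply, id]
    field_simp
    ring
  rw [h.deriv, abs_le]
  constructor <;> linarith [Real.sin_le_one (Real.log r), Real.neg_one_le_sin (Real.log r),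
      Real.cos_le_one (Real.log r), Real.neg_one_le_cos (Real.log r)]

theorem abs_deriv_h2_le {r : ℝ} (hr : 0 < r) : |deriv h2 r| ≤ 3 := by
  have hl := Real.hasDerivAt_log hr.ne'
  have h : HasDerivAt h2 (Real.cos (Real.log r) - 2 * Real.sin (Real.log r)) r := by
    have := ((hasDerivAt_id r).div_const 2).mul ((hl.cos.const_mul 3).sub hl.sin)
    refine this.congr_deriv ?_
    simp only [Pi.sub_apply, id]
    field_simp
    ring
  rw [h.deriv, abs_le]
  constructor <;> linarith [Real.sin_le_one (Real.log r), Real.neg_one_le_sin (Real.log r),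
      Real.cos_le_one (Real.log r), Real.neg_one_le_cos (Real.log r)]

theorem abs_mem_Icc_of_mem_Ioo {δ : ℝ} (hδ : δ ∈ Set.Ioo (-2 : ℝ) (-1)) :
    1 ≤ |δ| ∧ |δ| ≤ 2 := by
  rw [abs_of_neg (by linarith [hδ.2])]
  constructor <;> linarith [hδ.1, hδ.2]

theorem ne_zero_of_mem_Ioo {δ : ℝ} (hδ : δ ∈ Set.Ioo (-2 : ℝ) (-1)) : δ ≠ 0 :=
  (show δ < 0 by linarith [hδ.2]).ne

theorem mem_kernelBox_of_psiArg {r : ℝ} (hr : 0 < r) {m : Pt d}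
    (h : (psiArg r m).1 ∈ Set.Ioo (-2 : ℝ) (-1) ∧ ‖(psiArg r m).2.1‖ < 1 ∧
      ‖(psiArg r m).2.2‖ < 1) : m ∈ kernelBox d r := by
  obtain ⟨hδ, h1', h2'⟩ := h
  have hδ0 := ne_zero_of_mem_Ioo hδ
  obtain ⟨hδ1, hδ2⟩ := abs_mem_Icc_of_mem_Ioo hδ
  have hA := act_act_inv hδ0 hr (m.2.1, m.2.2)
  simp only [psiArg] at *
  set δ := m.1 / r ^ 2 with hδdef
  set p := act (Am δ r)⁻¹ (m.2.1, m.2.2)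
  have hy := congrArg Prod.fst hA
  have hw := congrArg Prod.snd hA
  rw [Am_eq hδ0] at hy hw
  simp only [act, Matrix.of_apply, Matrix.cons_val', Matrix.cons_val_zero, Matrix.cons_val_one,
    Matrix.cons_val_fin_one] at hy hw
  refine ⟨?_, ?_, ?_⟩
  · rw [show m.1 = δ * r ^ 2 by rw [hδdef]; field_simp, abs_mul,
      abs_of_pos (by positivity : 0 < r ^ 2)]
    gcongr
  · rw [← hy]
    refine (norm_add_le _ _).trans ?_
    rw [norm_smul, norm_smul, Real.norm_eq_abs, Real.norm_eq_abs, abs_mul]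
    calc _ ≤ r ^ 3 * 1 + (2 * r ^ 3) * 1 := by
          gcongr
          exacts [abs_g1_le hr, abs_g2_le hr]
      _ = _ := by ring
  · rw [← hw]
    refine (norm_add_le _ _).trans ?_
    rw [norm_smul, norm_smul, Real.norm_eq_abs, Real.norm_eq_abs, abs_div]
    calc _ ≤ (2 * r / 1) * 1 + (2 * r) * 1 := by
          gcongr
          exacts [abs_h1_le hr, abs_h2_le hr]
      _ = _ := by ring

theorem norm_psiArg_sub_le {r s : ℝ} (hr : 0 < r) (hs : s / r ^ 2 ∈ Set.Ioo (-2 : ℝ) (-1))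
    (y y' w : V d) :
    ‖psiArg r (s, y, w) - psiArg r (s, y', w)‖ ≤ 4 * r ^ (-3 : ℤ) * ‖y - y'‖ := by
  have hδ0 := ne_zero_of_mem_Ioo hs
  obtain ⟨hδ1, -⟩ := abs_mem_Icc_of_mem_Ioo hs
  have e : (4 : ℝ) * r ^ (-3 : ℤ) = 2 / r ^ 4 * (2 * r) := by
    rw [zpow_neg]; norm_cast; field_simp; norm_num
  have key : psiArg r (s, y, w) - psiArg r (s, y', w) =
      (0, (-(2 / r ^ 4) * h2 r) • (y - y'), (2 / r ^ 4 * (h1 r / (s / r ^ 2))) • (y - y')) := by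
    simp only [psiArg, Am_inv_eq hδ0 hr, act, Matrix.of_apply, Matrix.cons_val',
      Matrix.cons_val_zero, Matrix.cons_val_one, Matrix.cons_val_fin_one]
    refine Prod.ext ?_ (Prod.ext ?_ ?_)
    · simp
    · simp only [Prod.fst_sub, Prod.snd_sub]; module
    · simp only [Prod.snd_sub]; module
  rw [key, Prod.norm_def, Prod.norm_def, e]
  have h4 : (0 : ℝ) < 2 / r ^ 4 := by positivity
  refine max_le (by simpa using by positivity) (max_le ?_ ?_)
  · rw [norm_smul, Real.norm_eq_abs, abs_mul, abs_neg, abs_of_pos h4]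
    gcongr
    exact abs_h2_le hr
  · rw [norm_smul, Real.norm_eq_abs, abs_mul, abs_of_pos h4, abs_div]
    gcongr
    calc _ ≤ 2 * r / 1 := by gcongr; exact abs_h1_le hr
      _ = _ := by ring

theorem KernelBound.add {E : Type*} [NormedAddCommGroup E] {r B B' : ℝ} {J J' : Pt d → E}
    (h : KernelBound r B J) (h' : KernelBound r B' J') :
    KernelBound r (B + B') (fun m => J m + J' m) where
  bound m := (norm_add_le _ _).trans (add_le_add (h.bound m) (h'.bound m))
  supp m hm := by
    by_cases hJ : J m = 0
    · exact h'.supp m (by simpa [hJ] using hm)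
    · exact h.supp m hJ
  lip s w y y' := by
    rw [add_sub_add_comm, add_mul, add_mul]
    exact (norm_add_le _ _).trans (add_le_add (h.lip s w y y') (h'.lip s w y y'))

theorem ProfileBound.kernelBound {E : Type*} [NormedAddCommGroup E] [NormedSpace ℝ E]
    {M r K : ℝ} {Φ : Pt d → E} (hΦ : ProfileBound M Φ) (hM : 0 ≤ M) (hr : 0 < r) (hK : 0 ≤ K)
    {a : ℝ → ℝ} (ha : ∀ s, s / r ^ 2 ∈ Set.Ioo (-2 : ℝ) (-1) → |a s| ≤ K) :
    KernelBound r (4 * (K * M)) (fun m => a m.1 • Φ (psiArg r m)) where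
  bound m := by
    by_cases h : Φ (psiArg r m) = 0
    · simp only [h, smul_zero, norm_zero]; positivity
    · rw [norm_smul]
      have h1 : ‖a m.1‖ * ‖Φ (psiArg r m)‖ ≤ K * M := by
        gcongr
        · exact ha _ (hΦ.supp _ h).1
        · exact hΦ.bound _
      linarith [mul_nonneg hK hM]
  supp m hm := mem_kernelBox_of_psiArg hr (hΦ.supp _ fun h => hm (by simp [h]))
  lip s w y y' := by
    by_cases hs : s / r ^ 2 ∈ Set.Ioo (-2 : ℝ) (-1)
    · simp only
      rw [← smul_sub, norm_smul]
      calc _ ≤ K * (M * (4 * r ^ (-3 : ℤ) * ‖y - y'‖)) := by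
            gcongr
            · exact ha s hs
            · exact (hΦ.lip _ _).trans (by gcongr; exact norm_psiArg_sub_le hr hs y y' w)
        _ = _ := by ring
    · have h0 : ∀ y, Φ (psiArg r (s, y, w)) = 0 := fun y => by
        by_contra h
        exact hs (hΦ.supp _ h).1
      simp only [h0, smul_zero, sub_zero, norm_zero]
      positivity

theorem KernelBound.fderiv_bound {E : Type*} [NormedAddCommGroup E] [NormedSpace ℝ E] {r B : ℝ}
    {J : Pt d → E} (h : KernelBound r B J) (hr : 0 < r) (hB : 0 ≤ B) (ℓ : Fin d) (m : Pt d) :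
    ‖fderiv ℝ (fun y : V d => J (m.1, y, m.2.2)) m.2.1 (EuclideanSpace.single ℓ 1)‖ ≤
      B * r ^ (-3 : ℤ) := by
  have hf : ‖fderiv ℝ (fun y : V d => J (m.1, y, m.2.2)) m.2.1‖ ≤ B * r ^ (-3 : ℤ) :=
    norm_fderiv_le_of_lip' ℝ (by positivity) (Filter.Eventually.of_forall fun y => h.lip _ _ _ _)
  refine (ContinuousLinearMap.le_opNorm _ _).trans ?_
  simpa using hf

theorem KernelBound.fderiv_supp {E : Type*} [NormedAddCommGroup E] [NormedSpace ℝ E] {r B : ℝ}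
    {J : Pt d → E} (h : KernelBound r B J) (ℓ : Fin d) (m : Pt d)
    (hm : fderiv ℝ (fun y : V d => J (m.1, y, m.2.2)) m.2.1 (EuclideanSpace.single ℓ 1) ≠ 0) :
    m ∈ kernelBox d r := by
  by_contra hbox
  apply hm
  have hclosed : IsClosed (kernelBox d r) := by
    simp only [kernelBox, Set.ofPred_and]
    refine (isClosed_le ?_ ?_).inter ((isClosed_le ?_ ?_).inter (isClosed_le ?_ ?_)) <;> fun_prop
  have hcont : Continuous fun y : V d => ((m.1, y, m.2.2) : Pt d) := by fun_prop
  have hev : (fun y : V d => J (m.1, y, m.2.2)) =ᶠ[nhds m.2.1] fun _ => 0 := by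
    filter_upwards [(hclosed.isOpen_compl.preimage hcont).mem_nhds hbox] with y hy
    by_contra hJ
    exact hy (h.supp _ hJ)
  rw [hev.fderiv_eq]
  simp

end KernelBounds

section MaximalBounds

variable {d : ℕ}

theorem kernelBox_subset_kinBox {r : ℝ} (hr : 0 < r) : kernelBox d r ⊆ kinBox d (5 * r) := by
  rintro m ⟨h1, h2, h3⟩
  have := pow_pos hr 2
  have := pow_pos hr 3
  refine ⟨by nlinarith, by nlinarith, by linarith⟩

theorem kinBox_eq_prod (r : ℝ) : kinBox d r =
    Metric.ball (0 : ℝ) (r ^ 2) ×ˢ Metric.ball (0 : V d) (r ^ 3) ×ˢ Metric.ball (0 : V d) r := by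
  ext m
  simp [kinBox]

theorem isOpen_kinBox (r : ℝ) : IsOpen (kinBox d r) := by
  rw [kinBox_eq_prod]
  exact Metric.isOpen_ball.prod (Metric.isOpen_ball.prod Metric.isOpen_ball)

theorem volume_kinBox {r : ℝ} (hr : 0 < r) :
    volume (kinBox d r) = ENNReal.ofReal (r ^ (4 * d + 2)) * volume (kinBox d 1) := by
  simp only [kinBox_eq_prod, Measure.volume_eq_prod, Measure.prod_prod, one_pow]
  rw [Measure.addHaar_ball_of_pos _ _ (by positivity : 0 < r ^ 2),
    Measure.addHaar_ball_of_pos _ _ (by positivity : 0 < r ^ 3), Measure.addHaar_ball_of_pos _ _ hr]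
  have : ENNReal.ofReal (r ^ (4 * d + 2)) = ENNReal.ofReal ((r ^ 2) ^ 1) *
      (ENNReal.ofReal ((r ^ 3) ^ d) * ENNReal.ofReal (r ^ d)) := by
    rw [← ENNReal.ofReal_mul (by positivity), ← ENNReal.ofReal_mul (by positivity)]
    congr 1
    ring
  rw [this]
  simp only [Module.finrank_self, finrank_euclideanSpace, Fintype.card_fin]
  ring

theorem volume_kinBox_ne_top (r : ℝ) : volume (kinBox d r) ≠ ∞ := by
  rw [kinBox_eq_prod, Measure.volume_eq_prod, Measure.prod_prod, Measure.volume_eq_prod,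
    Measure.prod_prod]
  exact ENNReal.mul_ne_top measure_ball_lt_top.ne
    (ENNReal.mul_ne_top measure_ball_lt_top.ne measure_ball_lt_top.ne)

theorem volume_kinBox_ne_zero {r : ℝ} (hr : 0 < r) : volume (kinBox d r) ≠ 0 := by
  rw [kinBox_eq_prod, Measure.volume_eq_prod, Measure.prod_prod, Measure.volume_eq_prod,
    Measure.prod_prod]
  exact mul_ne_zero (Metric.measure_ball_pos _ _ (by positivity)).ne'
    (mul_ne_zero (Metric.measure_ball_pos _ _ (by positivity)).ne'
      (Metric.measure_ball_pos _ _ hr).ne')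

theorem kmul_kinv_kmul (z m : Pt d) : kmul (kinv z) (kmul z m) = m := by
  refine Prod.ext ?_ (Prod.ext ?_ ?_)
  · simp [kmul, kinv]
  · simp only [kmul, kinv]; module
  · simp [kmul, kinv]

theorem continuous_kmul (z : Pt d) : Continuous (kmul z) := by
  unfold kmul
  fun_prop

theorem measurePreserving_kmul (z : Pt d) : MeasurePreserving (kmul z) volume volume := by
  have hinv : (volume : Measure (V d × V d)).IsAddLeftInvariant :=
    inferInstanceAs ((volume : Measure (V d)).prod volume).IsAddLeftInvariant
  have hg : Continuous (Function.uncurry fun (t : ℝ) (p : V d × V d) =>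
      ((z.2.1 + t • z.2.2, z.2.2) : V d × V d) + p) := by
    unfold Function.uncurry
    fun_prop
  have h := (measurePreserving_add_left (volume : Measure ℝ) z.1).skew_product
    (μc := (volume : Measure (V d × V d))) (μd := (volume : Measure (V d × V d))) hg.measurable
    (Filter.Eventually.of_forall fun t => (measurePreserving_add_left _ _).map_eq)
  have hk : kmul z = fun p => (z.1 + p.1, (z.2.1 + p.1 • z.2.2, z.2.2) + p.2) := by
    funext m
    refine Prod.ext rfl (Prod.ext ?_ rfl)
    simp only [kmul, Prod.fst_add]
    abel
  rw [hk]
  exact h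

theorem ofReal_abs_integral_le {R c : ℝ} {I f : Pt d → ℝ} (hf : Measurable f) (z : Pt d)
    (hc : 0 ≤ c) (hI : ∀ m, |I m| ≤ c * |f m|)
    (hsupp : ∀ m, kmul (kinv z) m ∉ kinBox d R → I m = 0) :
    ENNReal.ofReal |∫ m, I m| ≤
      ENNReal.ofReal c * ∫⁻ m in kinBox d R, ENNReal.ofReal |f (kmul z m)| := by
  have hmeas : MeasurableSet (kinBox d R) := (isOpen_kinBox R).measurableSet
  have hf' : Measurable fun m => ENNReal.ofReal |f m| := by fun_prop
  set G : Pt d → ℝ≥0∞ := ((kmul (kinv z)) ⁻¹' kinBox d R).indicator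
    (fun m => ENNReal.ofReal |f m|) with hG
  have hGm : Measurable G := hf'.indicator ((continuous_kmul _).measurable hmeas)
  calc ENNReal.ofReal |∫ m, I m| = ‖∫ m, I m‖ₑ := by
        rw [← Real.norm_eq_abs, ofReal_norm]
    _ ≤ ∫⁻ m, ‖I m‖ₑ := enorm_integral_le_lintegral_enorm _
    _ ≤ ∫⁻ m, ENNReal.ofReal c * G m := by
        refine lintegral_mono fun m => ?_
        by_cases hm : kmul (kinv z) m ∈ kinBox d R
        · rw [hG, Set.indicator_of_mem (show m ∈ kmul (kinv z) ⁻¹' kinBox d R from hm), ← ENNReal.ofReal_mul hc,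
            ← ofReal_norm]
          exact ENNReal.ofReal_le_ofReal (hI m)
        · simp [hsupp m hm]
    _ = ENNReal.ofReal c * ∫⁻ m, G (kmul z m) := by
        rw [lintegral_const_mul _ hGm, (measurePreserving_kmul z).lintegral_comp hGm]
    _ = _ := by
        rw [← lintegral_indicator hmeas]
        congr 2
        funext m
        have hmem : kmul z m ∈ kmul (kinv z) ⁻¹' kinBox d R ↔ m ∈ kinBox d R := by
          rw [Set.mem_preimage, kmul_kinv_kmul]
        by_cases hm : m ∈ kinBox d R
        · rw [hG, Set.indicator_of_mem (hmem.2 hm), Set.indicator_of_mem hm]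
        · rw [hG, Set.indicator_of_notMem (mt hmem.1 hm), Set.indicator_of_notMem hm]

theorem lintegral_le_Mkin {R : ℝ} (hR : 0 < R) (f : Pt d → ℝ) (z : Pt d) :
    ∫⁻ m in kinBox d R, ENNReal.ofReal |f (kmul z m)| ≤ volume (kinBox d R) * Mkin f z := by
  refine le_trans (le_of_eq ?_) (mul_le_mul_right (le_iSup₂ (f := fun (r : ℝ) (_ : 0 < r) =>
    (volume (kinBox d r))⁻¹ * ∫⁻ m in kinBox d r, ENNReal.ofReal |f (kmul z m)|) R hR) _)
  rw [← mul_assoc, ENNReal.mul_inv_cancel (volume_kinBox_ne_zero hR) (volume_kinBox_ne_top R),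
    one_mul]

theorem ofReal_mul_lintegral_le_Mkin1 {R : ℝ} (hR : 0 < R) (f : Pt d → ℝ) (z : Pt d) :
    ENNReal.ofReal R * ∫⁻ m in kinBox d R, ENNReal.ofReal |f (kmul z m)| ≤
      volume (kinBox d R) * Mkin1 f z := by
  refine le_trans (le_of_eq ?_) (mul_le_mul_right (le_iSup₂ (f := fun (r : ℝ) (_ : 0 < r) =>
    ENNReal.ofReal r * ((volume (kinBox d r))⁻¹ *
      ∫⁻ m in kinBox d r, ENNReal.ofReal |f (kmul z m)|)) R hR) _)
  rw [mul_left_comm, ← mul_assoc (volume _), ENNReal.mul_inv_cancel (volume_kinBox_ne_zero hR)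
    (volume_kinBox_ne_top R), one_mul]

/-- The volume of the kinetic box of radius `5`. -/
def boxConst (d : ℕ) : ℝ := 5 ^ (4 * d + 2) * (volume (kinBox d 1)).toReal

theorem boxConst_nonneg : 0 ≤ boxConst d := by
  unfold boxConst
  positivity

theorem ofReal_mul_volume_kinBox {r : ℝ} (hr : 0 < r) (c : ℝ) :
    ENNReal.ofReal (c * r ^ (-(4 * (d : ℤ) + 2))) * volume (kinBox d (5 * r)) =
      ENNReal.ofReal (c * boxConst d) := by
  rw [volume_kinBox (by positivity), ← ENNReal.ofReal_toReal (volume_kinBox_ne_top (d := d) 1),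
    ← ENNReal.ofReal_mul (by positivity), ← ENNReal.ofReal_mul' (by positivity)]
  congr 1
  have : r ^ (-(4 * (d : ℤ) + 2)) * r ^ (4 * d + 2) = 1 := by
    rw [← zpow_natCast, ← zpow_add₀ hr.ne']
    simp
  rw [boxConst, mul_pow]
  linear_combination (c * 5 ^ (4 * d + 2) * (volume (kinBox d 1)).toReal) * this

theorem ofReal_abs_integral_le_Mkin {r c : ℝ} {I f : Pt d → ℝ} (hr : 0 < r) (hf : Measurable f)
    (z : Pt d) (hc : 0 ≤ c) (hI : ∀ m, |I m| ≤ c * r ^ (-(4 * (d : ℤ) + 2)) * |f m|)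
    (hsupp : ∀ m, I m ≠ 0 → kmul (kinv z) m ∈ kernelBox d r) :
    ENNReal.ofReal |∫ m, I m| ≤ ENNReal.ofReal (c * boxConst d) * Mkin f z := by
  refine (ofReal_abs_integral_le (R := 5 * r) hf z (by positivity) hI fun m hm => ?_).trans ?_
  · by_contra h
    exact hm (kernelBox_subset_kinBox hr (hsupp m h))
  · rw [← ofReal_mul_volume_kinBox hr, mul_assoc]
    gcongr
    exact lintegral_le_Mkin (by positivity) f z

theorem ofReal_abs_integral_le_Mkin1 {r c : ℝ} {I f : Pt d → ℝ} (hr : 0 < r) (hf : Measurable f)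
    (z : Pt d) (hc : 0 ≤ c) (hI : ∀ m, |I m| ≤ c * r * r ^ (-(4 * (d : ℤ) + 2)) * |f m|)
    (hsupp : ∀ m, I m ≠ 0 → kmul (kinv z) m ∈ kernelBox d r) :
    ENNReal.ofReal |∫ m, I m| ≤ ENNReal.ofReal (c * boxConst d) * Mkin1 f z := by
  refine (ofReal_abs_integral_le (R := 5 * r) (c := c * r ^ (-(4 * (d : ℤ) + 2)) * (5 * r)) hf z
    (by positivity) (fun m => (hI m).trans ?_) fun m hm => ?_).trans ?_
  · have : 0 ≤ c * r * r ^ (-(4 * (d : ℤ) + 2)) * |f m| := by positivity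
    linarith
  · by_contra h
    exact hm (kernelBox_subset_kinBox hr (hsupp m h))
  · rw [← ofReal_mul_volume_kinBox hr, ENNReal.ofReal_mul (by positivity), mul_assoc, mul_assoc]
    exact mul_le_mul_right (ofReal_mul_lintegral_le_Mkin1 (by positivity) f z) _

theorem ofReal_abs_Tvec_le {r c : ℝ} {J : Pt d → V d} {g : Pt d → V d} (hr : 0 < r)
    (hg : Measurable g) (z : Pt d) (hc : 0 ≤ c)
    (hJ : ∀ m, ‖J m‖ ≤ c * r ^ (-(4 * (d : ℤ) + 2))) (hs : ∀ m, J m ≠ 0 → m ∈ kernelBox d r) :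
    ENNReal.ofReal |Tvec J g z| ≤
      ENNReal.ofReal (c * boxConst d) * Mkin (fun m => ‖g m‖) z := by
  refine ofReal_abs_integral_le_Mkin hr hg.norm z hc (fun m => ?_) fun m hm => hs _ fun h => ?_
  · rw [abs_norm]
    exact (abs_real_inner_le_norm _ _).trans (by gcongr; exact hJ _)
  · simp [h] at hm

theorem ofReal_abs_Tsc_le {r c : ℝ} {J : Pt d → ℝ} {u : Pt d → ℝ} (hr : 0 < r)
    (hu : Measurable u) (z : Pt d) (hc : 0 ≤ c)
    (hJ : ∀ m, ‖J m‖ ≤ c * r * r ^ (-(4 * (d : ℤ) + 2))) (hs : ∀ m, J m ≠ 0 → m ∈ kernelBox d r) :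
    ENNReal.ofReal |Tsc J u z| ≤
      ENNReal.ofReal (c * boxConst d) * Mkin1 (fun m => |u m|) z := by
  refine ofReal_abs_integral_le_Mkin1 hr (hu.norm : Measurable fun m => |u m|) z hc
    (fun m => ?_) fun m hm => hs _ fun h => ?_
  · rw [Real.norm_eq_abs, abs_abs, abs_mul]
    gcongr
    exact hJ _
  · simp [h] at hm

end MaximalBounds

section KineticKernels

variable {d : ℕ} {ψ : Pt d → ℝ}

theorem IsKineticBump.fderiv_eq_zero (hψ : IsKineticBump ψ) {p : Pt d} (hp : ψ p = 0) :
    fderiv ℝ ψ p = 0 :=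
  IsLocalMin.fderiv_eq_zero (Filter.Eventually.of_forall fun q => hp ▸ hψ.nonneg q)

theorem IsKineticBump.contDiff_fderiv_apply (hψ : IsKineticBump ψ) (e : Fin d → Pt d) :
    ContDiff ℝ 1 fun p => mkV fun i => fderiv ℝ ψ p (e i) := by
  unfold mkV
  refine (EuclideanSpace.equiv (Fin d) ℝ).symm.contDiff.comp (contDiff_pi.2 fun i => ?_)
  exact (hψ.smooth.fderiv_right (m := 1) (by norm_cast)).clm_apply contDiff_const

theorem IsKineticBump.exists_profileBound_fderiv (hψ : IsKineticBump ψ) (e : Fin d → Pt d) :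
    ∃ M, 0 ≤ M ∧ ProfileBound M fun p => mkV fun i => fderiv ℝ ψ p (e i) := by
  refine exists_profileBound (hψ.contDiff_fderiv_apply e) fun p hp => hψ.supp p fun h => hp ?_
  simp only [hψ.fderiv_eq_zero h, zero_apply]
  exact map_zero (EuclideanSpace.equiv (Fin d) ℝ).symm

theorem IsKineticBump.exists_profileBound_smul (hψ : IsKineticBump ψ) {L : Pt d → V d}
    (hL : ContDiff ℝ 1 L) : ∃ M, 0 ≤ M ∧ ProfileBound M fun p => ψ p • L p := by
  refine exists_profileBound ((hψ.smooth.of_le (by norm_cast)).smul hL) fun p hp =>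
    hψ.supp p fun h => hp ?_
  simp [h]

theorem abs_time_le {r s : ℝ} (hr : 0 < r) (hs : s / r ^ 2 ∈ Set.Ioo (-2 : ℝ) (-1)) :
    |s| ≤ 2 * r ^ 2 := by
  have h := (abs_mem_Icc_of_mem_Ioo hs).2
  rwa [abs_div, abs_of_pos (by positivity : 0 < r ^ 2), div_le_iff₀ (by positivity)] at h

theorem exists_kernelBound_Kvec (hψ : IsKineticBump ψ) :
    ∃ c, 0 ≤ c ∧ ∀ r, 0 < r → KernelBound r (c * r ^ (-(4 * (d : ℤ) + 2))) (Kvec ψ r) := by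
  obtain ⟨M₁, hM₁, h₁⟩ := hψ.exists_profileBound_smul (L := fun p => p.2.1) (by fun_prop)
  obtain ⟨M₂, hM₂, h₂⟩ := hψ.exists_profileBound_smul (L := fun p => p.2.2) (by fun_prop)
  refine ⟨4 * (2 ^ d * 3 * M₁) + 4 * (2 ^ d * 3 * M₂), by positivity, fun r hr => ?_⟩
  set q := r ^ (-(4 * (d : ℤ) + 2)) with hq
  have hq0 : 0 < q := by positivity
  have k₁ := h₁.kernelBound hM₁ hr (K := 2 ^ d * q * 3) (by positivity)
    (a := fun s => -(2 ^ d) * q * F1 (s / r ^ 2) r) fun s hs => by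
      rw [abs_mul, abs_mul, abs_neg, abs_of_pos (by positivity : (0 : ℝ) < 2 ^ d), abs_of_pos hq0]
      gcongr
      rw [F1, abs_mul, abs_div, abs_one]
      calc _ ≤ (1 / 1 * 3 : ℝ) := by
            gcongr
            · exact (abs_mem_Icc_of_mem_Ioo hs).1
            · exact abs_deriv_h1_le hr
        _ = 3 := by norm_num
  have k₂ := h₂.kernelBound hM₂ hr (K := 2 ^ d * q * 3) (by positivity)
    (a := fun _ => -(2 ^ d) * q * F2 r) fun s hs => by
      rw [abs_mul, abs_mul, abs_neg, abs_of_pos (by positivity : (0 : ℝ) < 2 ^ d), abs_of_pos hq0]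
      gcongr
      exact abs_deriv_h2_le hr
  convert k₁.add k₂ using 1
  · ring
  · funext m
    simp only [Kvec, psiArg, ← hq]
    module

theorem exists_kernelBound_Kpi (hψ : IsKineticBump ψ) :
    ∃ c, 0 ≤ c ∧ ∀ r, 0 < r → KernelBound r (c * r ^ (-(4 * (d : ℤ) + 2))) (Kpi ψ r) := by
  obtain ⟨M₁, hM₁, h₁⟩ :=
    hψ.exists_profileBound_fderiv fun i => (0, EuclideanSpace.single i 1, 0)
  obtain ⟨M₂, hM₂, h₂⟩ :=
    hψ.exists_profileBound_fderiv fun i => (0, 0, EuclideanSpace.single i 1)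
  refine ⟨4 * (2 ^ (d + 1) * 8 * M₁) + 4 * (2 ^ (d + 1) * 8 * M₂), by positivity, fun r hr => ?_⟩
  set q := r ^ (-(4 * (d : ℤ) + 2)) with hq
  have hq0 : 0 < q := by positivity
  have hq1 : r ^ (-(4 * (d : ℤ) + 2) - 1) = q / r := zpow_sub_one₀ hr.ne' _
  have coeff : ∀ (s b : ℝ), s / r ^ 2 ∈ Set.Ioo (-2 : ℝ) (-1) → |b| ≤ 4 / r →
      |2 ^ (d + 1) * s * (q / r) * b| ≤ 2 ^ (d + 1) * q * 8 := fun s b hs hb => by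
    rw [abs_mul, abs_mul, abs_mul, abs_of_pos (by positivity : (0 : ℝ) < 2 ^ (d + 1)),
      abs_of_pos (by positivity : 0 < q / r)]
    calc _ ≤ 2 ^ (d + 1) * (2 * r ^ 2) * (q / r) * (4 / r) := by
          gcongr
          exact abs_time_le hr hs
      _ = _ := by field_simp; ring
  have k₁ := h₁.kernelBound hM₁ hr (K := 2 ^ (d + 1) * q * 8) (by positivity)
    (a := fun s => 2 ^ (d + 1) * s * (q / r) * (Am (s / r ^ 2) r)⁻¹ 0 1) fun s hs => by
      refine coeff s _ hs ?_
      simp only [Am_inv_eq (ne_zero_of_mem_Ioo hs) hr, Matrix.of_apply, Matrix.cons_val',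
        Matrix.cons_val_zero, Matrix.cons_val_one, Matrix.cons_val_fin_one]
      rw [abs_mul, abs_mul, abs_of_pos (by positivity : 0 < 2 / r ^ 4)]
      calc _ ≤ 2 / r ^ 4 * (2 * r ^ 3) := by
            gcongr
            · exact (abs_mem_Icc_of_mem_Ioo hs).2
            · exact abs_g2_le hr
        _ = 4 / r := by field_simp; norm_num
  have k₂ := h₂.kernelBound hM₂ hr (K := 2 ^ (d + 1) * q * 8) (by positivity)
    (a := fun s => 2 ^ (d + 1) * s * (q / r) * (Am (s / r ^ 2) r)⁻¹ 1 1) fun s hs => by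
      refine coeff s _ hs ?_
      simp only [Am_inv_eq (ne_zero_of_mem_Ioo hs) hr, Matrix.of_apply, Matrix.cons_val',
        Matrix.cons_val_one, Matrix.cons_val_fin_one]
      rw [abs_mul, abs_neg, abs_of_pos (by positivity : 0 < 2 / r ^ 4)]
      calc _ ≤ 2 / r ^ 4 * (2 * r ^ 3) := by
            gcongr
            linarith [abs_g1_le hr, pow_pos hr 3]
        _ = 4 / r := by field_simp; norm_num
  convert k₁.add k₂ using 1
  · ring
  · funext m
    simp only [Kpi, gradX, gradV, hq1]
    module

theorem exists_kernelBound_Ktil (hψ : IsKineticBump ψ) :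
    ∃ c, 0 ≤ c ∧ ∀ r, 0 < r → KernelBound r (c * r * r ^ (-(4 * (d : ℤ) + 2))) (Ktil ψ r) := by
  obtain ⟨M, hM, h⟩ := exists_profileBound (hψ.smooth.of_le (by norm_cast)) hψ.supp
  refine ⟨4 * (2 ^ (d + 1) * 2 * M), by positivity, fun r hr => ?_⟩
  set q := r ^ (-(4 * (d : ℤ) + 2)) with hq
  have hq0 : 0 < q := by positivity
  have hq1 : r ^ (-(4 * (d : ℤ) + 2) - 1) = q / r := zpow_sub_one₀ hr.ne' _
  have k := h.kernelBound hM hr (K := 2 ^ (d + 1) * 2 * r * q) (by positivity)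
    (a := fun s => -(2 ^ (d + 1)) * s * (q / r)) fun s hs => by
      rw [abs_mul, abs_mul, abs_neg, abs_of_pos (by positivity : (0 : ℝ) < 2 ^ (d + 1)),
        abs_of_pos (by positivity : 0 < q / r)]
      calc _ ≤ 2 ^ (d + 1) * (2 * r ^ 2) * (q / r) := by
            gcongr
            exact abs_time_le hr hs
        _ = _ := by field_simp
  convert k using 1
  · ring
  · funext m
    simp only [Ktil, hq1, smul_eq_mul]

end KineticKernels

/-- **Pointwise maximal-function domination for the kinetic kernels**
(Step 3 of the proof of Theorem 4.2). -/
theorem statement16 (d : ℕ) (hd : 1 ≤ d) (ψ : Pt d → ℝ) (hψ : IsKineticBump ψ) :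
    ∃ C : ℝ, 0 < C ∧ ∀ r : ℝ, 0 < r → ∀ z : Pt d,
      ∀ g : Pt d → V d, Measurable g → (∃ M : ℝ, ∀ m, ‖g m‖ ≤ M) →
      ∀ u : Pt d → ℝ, Measurable u → (∃ M : ℝ, ∀ m, |u m| ≤ M) →
      ∀ ℓ : Fin d,
        (ENNReal.ofReal |Tvec (Kvec ψ r) g z| + ENNReal.ofReal |Tvec (Kpi ψ r) g z| ≤
          ENNReal.ofReal C * Mkin (fun m => ‖g m‖) z) ∧
        (ENNReal.ofReal |Tvec (pdYv (Kvec ψ r) ℓ) g z| +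
            ENNReal.ofReal |Tvec (pdYv (Kpi ψ r) ℓ) g z| ≤
          ENNReal.ofReal (C * r ^ (-3 : ℤ)) * Mkin (fun m => ‖g m‖) z) ∧
        (ENNReal.ofReal |Tsc (Ktil ψ r) u z| ≤
          ENNReal.ofReal C * Mkin1 (fun m => |u m|) z) ∧
        (ENNReal.ofReal |Tsc (pdYs (Ktil ψ r) ℓ) u z| ≤
          ENNReal.ofReal (C * r ^ (-3 : ℤ)) * Mkin1 (fun m => |u m|) z) := by
  obtain ⟨c₁, hc₁, k₁⟩ := exists_kernelBound_Kvec hψ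
  obtain ⟨c₂, hc₂, k₂⟩ := exists_kernelBound_Kpi hψ
  obtain ⟨c₃, hc₃, k₃⟩ := exists_kernelBound_Ktil hψ
  have hb := boxConst_nonneg (d := d)
  refine ⟨(c₁ + c₂ + c₃) * boxConst d + 1, by positivity, ?_⟩
  intro r hr z g hg _ u hu _ ℓ
  have hq : 0 < r ^ (-(4 * (d : ℤ) + 2)) := by positivity
  have hr3 : 0 < r ^ (-3 : ℤ) := by positivity
  have hle : (c₁ + c₂) * boxConst d ≤ (c₁ + c₂ + c₃) * boxConst d + 1 := by nlinarith
  have hle' : c₃ * boxConst d ≤ (c₁ + c₂ + c₃) * boxConst d + 1 := by nlinarith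
  refine ⟨?_, ?_, ?_, ?_⟩
  · refine (add_le_add (ofReal_abs_Tvec_le hr hg z hc₁ (k₁ r hr).bound (k₁ r hr).supp)
      (ofReal_abs_Tvec_le hr hg z hc₂ (k₂ r hr).bound (k₂ r hr).supp)).trans ?_
    rw [← add_mul, ← ENNReal.ofReal_add (by positivity) (by positivity), ← add_mul]
    gcongr
  · refine (add_le_add
      (ofReal_abs_Tvec_le (c := c₁ * r ^ (-3 : ℤ)) hr hg z (by positivity)
        (fun m => ((k₁ r hr).fderiv_bound hr (by positivity) ℓ m).trans_eq (by ring))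
        ((k₁ r hr).fderiv_supp ℓ))
      (ofReal_abs_Tvec_le (c := c₂ * r ^ (-3 : ℤ)) hr hg z (by positivity)
        (fun m => ((k₂ r hr).fderiv_bound hr (by positivity) ℓ m).trans_eq (by ring))
        ((k₂ r hr).fderiv_supp ℓ))).trans ?_
    rw [← add_mul, ← ENNReal.ofReal_add (by positivity) (by positivity), ← add_mul, ← add_mul,
      mul_right_comm]
    gcongr
  · refine (ofReal_abs_Tsc_le hr hu z hc₃ (k₃ r hr).bound (k₃ r hr).supp).trans ?_
    gcongr
  · refine (ofReal_abs_Tsc_le (c := c₃ * r ^ (-3 : ℤ)) hr hu z (by positivity)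
      (fun m => ((k₃ r hr).fderiv_bound hr (by positivity) ℓ m).trans_eq (by ring))
      ((k₃ r hr).fderiv_supp ℓ)).trans ?_
    rw [mul_right_comm]
    gcongr
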